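/- Let n >= 1, let q be a prime power, and let -1 <= i <= n-2. Let pi be an n-dimensional projective subspace of PG(2n+1,q^2) such that pi intersect pi^sigma has projective dimension i. Let P be a point of H(2n+1,q^2) lying on pi but not on pi intersect pi^sigma, and let P' be a point of H(2n+1,q^2) lying on pi^sigma but not on pi intersect pi^sigma. Then the number of generators mu of H(2n+1,q^2) such that P is the unique point lying on both mu and pi and P' is the unique point lying on both mu and pi^sigma equals N(n,i) = q^{(n-1)^2 - binom(n-i-1,2)} * prod_{j=1}^{n-i-2} (q^j - (-1)^j). -/

import Mathlib

open scoped BigOperators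

namespace HermCode

/-- The Hermitian sesquilinear form `h(x,y) = ∑ᵢ xᵢ * yᵢ^q` on `F^m`. -/
def herm (q : ℕ) {F : Type} [Field F] {m : ℕ} (x y : Fin m → F) : F :=
  ∑ i, x i * (y i) ^ q

/-- For a fixed vector `x`, the linear map `y ↦ h(y,x)`. -/
def hermL (q : ℕ) {F : Type} [Field F] {m : ℕ} (x : Fin m → F) :
    (Fin m → F) →ₗ[F] F where
  toFun y := herm q y x
  map_add' a b := by
    simp [herm, add_mul, Finset.sum_add_distrib]
  map_smul' c a := by
    simp [herm, Finset.mul_sum, mul_assoc]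

/-- The image `W^σ` of a subspace `W` under the Hermitian polarity `σ`:
the subspace of all vectors orthogonal to every vector of `W`
with respect to the Hermitian form. -/
def polar (q : ℕ) {F : Type} [Field F] {m : ℕ} (W : Submodule F (Fin m → F)) :
    Submodule F (Fin m → F) :=
  ⨅ x : W, LinearMap.ker (hermL q (x : Fin m → F))

/-- A subspace all of whose points lie on the Hermitian variety. -/
def TotallyIsotropic (q : ℕ) {F : Type} [Field F] {m : ℕ}
    (W : Submodule F (Fin m → F)) : Prop :=
  ∀ x ∈ W, herm q x x = 0

/-- A point of the Hermitian variety: a projective point (1-dimensional subspace)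
spanned by an isotropic vector. -/
def IsHermPoint (q : ℕ) {F : Type} [Field F] {m : ℕ}
    (P : Submodule F (Fin m → F)) : Prop :=
  Module.finrank F P = 1 ∧ TotallyIsotropic q P

/-- A generator of `H(2n+1,q²)`: an `n`-dimensional projective subspace all of
whose points lie on the Hermitian variety. -/
def IsGenerator (q n : ℕ) {F : Type} [Field F]
    (W : Submodule F (Fin (2*n+2) → F)) : Prop :=
  Module.finrank F W = n + 1 ∧ TotallyIsotropic q W

/-- A code word of the dual code `C_n(H(2n+1,q²))^⊥`: a function from points to `F_p`
(vanishing off the Hermitian variety) summing to zero over every generator. -/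
def IsCodeword (p q n : ℕ) {F : Type} [Field F]
    (c : Submodule F (Fin (2*n+2) → F) → ZMod p) : Prop :=
  (∀ P, ¬ IsHermPoint q P → c P = 0) ∧
  ∀ μ, IsGenerator q n μ → (∑ᶠ P ∈ {P | IsHermPoint q P ∧ P ≤ μ}, c P) = 0

/-- The (Hamming) weight of a code word. -/
noncomputable def wt {p : ℕ} {α : Type*} (c : α → ZMod p) : ℕ :=
  Nat.card {x : α // c x ≠ 0}

open scoped Classical in
/-- The incidence vector `v_π` of `π ∩ H`. -/
noncomputable def vsub (p q : ℕ) {F : Type} [Field F] {m : ℕ}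
    (π : Submodule F (Fin m → F)) : Submodule F (Fin m → F) → ZMod p :=
  fun P => if IsHermPoint q P ∧ P ≤ π then 1 else 0

/-- `θ_m(q)`, the number of points of `PG(m,q)`. -/
noncomputable def theta (q : ℕ) (m : ℤ) : ℚ :=
  ((q:ℚ)^(m+1) - 1) / ((q:ℚ) - 1)

/-- `μ_m(q²)`, the number of points of `H(m,q²)` (with `μ_{-1} = 0`). -/
noncomputable def muH (q : ℕ) (m : ℤ) : ℚ :=
  (((q:ℚ)^(m+1) - (-1:ℚ)^(m+1)) * ((q:ℚ)^m - (-1:ℚ)^m)) / ((q:ℚ)^2 - 1)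

/-- The number `N(n,i)`. -/
noncomputable def NN (q n : ℕ) (i : ℤ) : ℚ :=
  (q:ℚ)^(((n:ℤ)-1)^2 - ((((n:ℤ)-i-1).toNat.choose 2 : ℕ) : ℤ)) *
    ∏ j ∈ Finset.range ((n:ℤ)-i-2).toNat, ((q:ℚ)^(j+1) - (-1:ℚ)^(j+1))

open scoped Classical in
/-- The quantity `Σ_{n,i}`. -/
noncomputable def SigmaNI (q n : ℕ) (i : ℤ) : ℚ :=
  if Odd ((n:ℤ) - i) then
    2*(q:ℚ)^(2*i+2) * muH q ((n:ℤ)-i-1)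
      + 4 * muH q ((n:ℤ)-i-2) * ((q:ℚ)^((n:ℤ)-i-1) - 1)
          / ((q:ℚ)^((n:ℤ)-3*i-5) * ((q:ℚ)^2 - 1))
  else
    2*(q:ℚ)^(2*i+2) * (muH q ((n:ℤ)-i-1)
      + 2*((q:ℚ)^(4:ℤ) * muH q ((n:ℤ)-i-3) + (q:ℚ)^2 - 1)/((q:ℚ)^2 - 1))

/-- `P` lies on a projective line entirely contained in the Hermitian variety that
meets both `π \ (π ⊓ π^σ)` and `π^σ \ (π ⊓ π^σ)`. -/
def OnGoodLine (q : ℕ) {F : Type} [Field F] {m : ℕ}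
    (π P : Submodule F (Fin m → F)) : Prop :=
  ∃ A B : Submodule F (Fin m → F),
    Module.finrank F A = 1 ∧ A ≤ π ∧ ¬ A ≤ π ⊓ polar q π ∧
    Module.finrank F B = 1 ∧ B ≤ polar q π ∧ ¬ B ≤ π ⊓ polar q π ∧
    P ≤ A ⊔ B ∧ TotallyIsotropic q (A ⊔ B)

set_option linter.unusedSectionVars false
open Module

/-- The field `F` has `q^2` elements and `x ↦ x^q` is additive. -/
structure Good (q : ℕ) (F : Type) [Field F] [Fintype F] : Prop where
  two_le : 2 ≤ q
  add : ∀ a b : F, (a + b) ^ q = a ^ q + b ^ q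
  frob : ∀ a : F, (a ^ q) ^ q = a
  card : Fintype.card F = q ^ 2

theorem good_of (p hh q : ℕ) (hp : p.Prime) (hh1 : 1 ≤ hh)
    (hq : q = p ^ hh) (F : Type) [Field F] [Fintype F] (hF : Fintype.card F = q ^ 2) :
    Good q F := by
  have : Fact p.Prime := ⟨hp⟩
  have hc : Fintype.card F = p ^ (hh * 2) := by rw [hF, hq, pow_mul]
  have : CharP F p := by
    obtain ⟨p', hp'⟩ := CharP.exists F
    obtain ⟨k, hk1, hk⟩ := FiniteField.card F p'
    have h1 : p' ∣ p ^ (hh * 2) := by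
      rw [← hc, hk]; exact dvd_pow_self _ k.ne_zero
    have h2 := (Nat.prime_dvd_prime_iff_eq hk1 hp).1 (hk1.dvd_of_dvd_pow h1)
    rwa [h2] at hp'
  refine ⟨?_, ?_, ?_, hF⟩
  · rw [hq]
    calc 2 ≤ p := hp.two_le
      _ ≤ p ^ hh := Nat.le_self_pow (by omega) p
  · intro a b
    rw [hq]; exact add_pow_char_pow a b p hh
  · intro a
    rw [← pow_mul, ← sq, ← hF]; exact FiniteField.pow_card a

section field

variable {q : ℕ} {F : Type} [Field F] [Fintype F]

theorem fiber_exact {α β : Type*} [DecidableEq β] (S : Finset α) (K : Finset β) (f : α → β)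
    (a b : ℕ) (hm : ∀ x ∈ S, f x ∈ K) (ha : ∀ k ∈ K, (S.filter (fun x => f x = k)).card ≤ a)
    (hb : K.card ≤ b) (hS : S.card = a * b) (k : β) (hk : k ∈ K) :
    (S.filter (fun x => f x = k)).card = a := by
  have h1 := Finset.card_eq_sum_card_fiberwise (f := f) (s := S) (t := K) hm
  by_contra hne
  have hlt : (S.filter (fun x => f x = k)).card < a := lt_of_le_of_ne (ha k hk) hne
  have h2 : ∑ k ∈ K, (S.filter (fun x => f x = k)).card < ∑ k ∈ K, a :=
    Finset.sum_lt_sum ha ⟨k, hk, hlt⟩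
  rw [← h1, hS, Finset.sum_const, smul_eq_mul, mul_comm] at h2
  exact absurd h2 (not_lt.2 (Nat.mul_le_mul_right _ hb))

open Polynomial in
theorem poly_bound [DecidableEq F] (P : F[X]) (hP : P ≠ 0) (S : Finset F)
    (h : ∀ x ∈ S, P.eval x = 0) : S.card ≤ P.natDegree := by
  refine le_trans (Finset.card_le_card (t := P.roots.toFinset) ?_)
    (le_trans (Multiset.toFinset_card_le _) (Polynomial.card_roots' P))
  intro x hx
  simp [hP, Polynomial.IsRoot, h x hx]

open Polynomial in
theorem trace_count (hg : Good q F) (c : F) (hc : c ^ q = c) :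
    Nat.card {t : F // t + t ^ q = c} = q := by
  classical
  have hq := hg.two_le
  have h := fiber_exact (Finset.univ : Finset F) (Finset.univ.filter (fun k : F => k ^ q = k))
    (fun t => t + t ^ q) q q ?_ ?_ ?_ ?_ c (by simpa using hc)
  · rw [Nat.card_eq_fintype_card, Fintype.card_subtype]; exact h
  · intro x _
    simp [hg.add, hg.frob, add_comm]
  · intro k _
    have hd : (X ^ q + (X - C k) : F[X]).natDegree = q := by
      rw [natDegree_add_eq_left_of_natDegree_lt] <;> simp; omega
    have := poly_bound (X ^ q + (X - C k) : F[X]) (by intro h0; rw [h0] at hd; simp at hd; omega)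
      (Finset.univ.filter (fun x : F => x + x ^ q = k)) (by
        intro x hx
        simp at hx ⊢
        rw [← hx]; ring)
    rwa [hd] at this
  · have hd : (X ^ q - X : F[X]).natDegree = q := by
      rw [natDegree_sub_eq_left_of_natDegree_lt] <;> simp; omega
    have := poly_bound (X ^ q - X : F[X]) (by intro h0; rw [h0] at hd; simp at hd; omega)
      (Finset.univ.filter (fun x : F => x ^ q = x)) (by
        intro x hx
        simp at hx ⊢
        rw [hx]; ring)
    rwa [hd] at this
  · rw [Finset.card_univ, hg.card]; ring

open Polynomial in
theorem norm_count (hg : Good q F) (c : F) (hc : c ^ q = c) (hc0 : c ≠ 0) :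
    Nat.card {t : F // t * t ^ q = c} = q + 1 := by
  classical
  have hq := hg.two_le
  have h := fiber_exact ((Finset.univ : Finset F).erase 0)
    (Finset.univ.filter (fun k : F => k ^ (q - 1) = 1))
    (fun t => t * t ^ q) (q + 1) (q - 1) ?_ ?_ ?_ ?_ c ?_
  · rw [Nat.card_eq_fintype_card, Fintype.card_subtype]
    rw [← h]
    congr 1
    ext x
    simp only [Finset.mem_filter, Finset.mem_univ, true_and, Finset.mem_erase, and_true]
    constructor
    · intro hx
      refine ⟨?_, hx⟩
      rintro rfl
      apply hc0; rw [← hx]; simp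
    · exact fun hx => hx.2
  · intro x hx
    simp at hx
    simp only [Finset.mem_filter, Finset.mem_univ, true_and]
    have h0 : x * x ^ q ≠ 0 := mul_ne_zero hx (pow_ne_zero _ hx)
    apply mul_right_cancel₀ h0
    rw [← pow_succ, Nat.sub_add_cancel (by omega), mul_pow, hg.frob]; ring
  · intro k _
    have hd : (X ^ (q + 1) - C k : F[X]).natDegree = q + 1 := by
      rw [natDegree_sub_eq_left_of_natDegree_lt] <;> simp
    have := poly_bound (X ^ (q + 1) - C k : F[X]) (by intro h0; rw [h0] at hd; simp at hd)
      (((Finset.univ : Finset F).erase 0).filter (fun x : F => x * x ^ q = k)) (by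
        intro x hx
        simp at hx ⊢
        rw [← hx.2]; ring)
    rwa [hd] at this
  · have hd : (X ^ (q - 1) - C 1 : F[X]).natDegree = q - 1 := by
      rw [natDegree_sub_eq_left_of_natDegree_lt] <;> simp; omega
    have := poly_bound (X ^ (q - 1) - C 1 : F[X])
      (by intro h0; rw [h0] at hd; simp at hd; omega)
      (Finset.univ.filter (fun x : F => x ^ (q - 1) = 1)) (by
        intro x hx
        simp at hx ⊢
        rw [hx]; ring)
    rwa [hd] at this
  · rw [Finset.card_erase_of_mem (Finset.mem_univ _), Finset.card_univ, hg.card]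
    obtain ⟨k, rfl⟩ := Nat.exists_eq_add_of_le hq
    rw [show 2 + k - 1 = k + 1 by omega, Nat.sub_eq_iff_eq_add (by nlinarith)]
    ring
  · simp only [Finset.mem_filter, Finset.mem_univ, true_and]
    apply mul_right_cancel₀ hc0
    rw [← pow_succ, Nat.sub_add_cancel (by omega), hc]; ring

theorem exists_trace_ne (hg : Good q F) : ∃ t : F, t + t ^ q ≠ 0 := by
  by_contra! h
  have h1 := trace_count hg 0 (by have := hg.two_le; simp; omega)
  rw [Nat.card_congr (Equiv.subtypeUnivEquiv h), Nat.card_eq_fintype_card, hg.card] at h1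
  have := hg.two_le
  nlinarith

end field
section form

variable {q : ℕ} {F : Type} [Field F] [Fintype F] {N : ℕ}

theorem mem_polar {W : Submodule F (Fin N → F)} {y : Fin N → F} :
    y ∈ polar q W ↔ ∀ x ∈ W, herm q y x = 0 := by
  simp only [polar, Submodule.mem_iInf, Subtype.forall, LinearMap.mem_ker]
  rfl

/-- The hyperplane orthogonal to a vector. -/
def perp (q : ℕ) {F : Type} [Field F] {N : ℕ} (x : Fin N → F) : Submodule F (Fin N → F) :=
  LinearMap.ker (hermL q x)

theorem mem_perp {x y : Fin N → F} : y ∈ perp q x ↔ herm q y x = 0 := Iff.rfl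

theorem herm_add_left (x y z : Fin N → F) : herm q (x + y) z = herm q x z + herm q y z := by
  simp [herm, add_mul, Finset.sum_add_distrib]

theorem herm_smul_left (c : F) (x z : Fin N → F) : herm q (c • x) z = c * herm q x z := by
  simp [herm, Finset.mul_sum, mul_assoc]

theorem herm_zero_left (z : Fin N → F) : herm q 0 z = 0 := by
  simp [herm]

theorem herm_neg_left (x z : Fin N → F) : herm q (-x) z = - herm q x z := by
  simp [herm]

theorem herm_sub_left (x y z : Fin N → F) : herm q (x - y) z = herm q x z - herm q y z := by
  rw [sub_eq_add_neg, herm_add_left, herm_neg_left, sub_eq_add_neg]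

theorem sum_frob (hg : Good q F) {ι : Type*} (s : Finset ι) (f : ι → F) :
    (∑ i ∈ s, f i) ^ q = ∑ i ∈ s, f i ^ q := by
  classical
  have := hg.two_le
  induction s using Finset.induction_on with
  | empty => simp; omega
  | insert a s ha ih => rw [Finset.sum_insert ha, Finset.sum_insert ha, hg.add, ih]

theorem frob_zero (hg : Good q F) : (0 : F) ^ q = 0 := by
  have := hg.two_le
  simp; omega

theorem frob_neg (hg : Good q F) (a : F) : (-a) ^ q = - a ^ q := by
  have h := hg.add a (-a)
  rw [add_neg_cancel, frob_zero hg] at h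
  exact (neg_eq_of_add_eq_zero_right h.symm).symm

theorem herm_symm (hg : Good q F) (x y : Fin N → F) : herm q y x = (herm q x y) ^ q := by
  rw [herm, herm, sum_frob hg]
  refine Finset.sum_congr rfl fun i _ => ?_
  rw [mul_pow, hg.frob, mul_comm]

theorem herm_self (hg : Good q F) (x : Fin N → F) : (herm q x x) ^ q = herm q x x :=
  (herm_symm hg x x).symm

theorem herm_zero_symm (hg : Good q F) {x y : Fin N → F} (h : herm q x y = 0) :
    herm q y x = 0 := by
  rw [herm_symm hg, h, frob_zero hg]

theorem herm_ne_symm (hg : Good q F) {x y : Fin N → F} (h : herm q x y ≠ 0) :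
    herm q y x ≠ 0 := fun h' => h (herm_zero_symm hg h')

theorem herm_add_right (hg : Good q F) (x y z : Fin N → F) :
    herm q z (x + y) = herm q z x + herm q z y := by
  simp [herm, mul_add, hg.add, Finset.sum_add_distrib]

theorem herm_smul_right (c : F) (x z : Fin N → F) :
    herm q z (c • x) = c ^ q * herm q z x := by
  simp only [herm, Finset.mul_sum, Pi.smul_apply, smul_eq_mul, mul_pow]
  exact Finset.sum_congr rfl fun i _ => by ring

theorem herm_neg_right (hg : Good q F) (x z : Fin N → F) : herm q z (-x) = - herm q z x := by
  simp [herm, frob_neg hg]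

theorem herm_sub_right (hg : Good q F) (x y z : Fin N → F) :
    herm q z (x - y) = herm q z x - herm q z y := by
  rw [sub_eq_add_neg, herm_add_right hg, herm_neg_right hg, sub_eq_add_neg]

/-- A totally isotropic subspace is self-orthogonal. -/
theorem ti_orth (hg : Good q F) {W : Submodule F (Fin N → F)} (hW : TotallyIsotropic q W)
    {x y : Fin N → F} (hx : x ∈ W) (hy : y ∈ W) : herm q x y = 0 := by
  by_contra hne
  obtain ⟨t, ht⟩ := exists_trace_ne hg
  have h1 := hW _ (W.add_mem (W.smul_mem (t / herm q x y) hx) hy)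
  rw [herm_add_left, herm_add_right hg, herm_add_right hg, herm_smul_left, herm_smul_left,
    hW y hy, herm_smul_right, hW x hx, herm_smul_right, herm_symm hg x y, ← mul_pow,
    div_mul_cancel₀ _ hne] at h1
  apply ht
  simpa using h1

/-- A subspace on which the form is nondegenerate. -/
def Nondeg (q : ℕ) {F : Type} [Field F] {N : ℕ} (U : Submodule F (Fin N → F)) : Prop :=
  ∀ x ∈ U, (∀ y ∈ U, herm q x y = 0) → x = 0

theorem nondeg_top (hg : Good q F) : Nondeg q (⊤ : Submodule F (Fin N → F)) := by
  intro x _ h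
  ext i
  have := h (Pi.single i 1) trivial
  have h0 := hg.two_le
  rw [herm, Finset.sum_eq_single i] at this
  · simpa using this
  · intro j _ hj
    simp [hj]; right; omega
  · simp

theorem exists_aniso (hg : Good q F) {U : Submodule F (Fin N → F)} (hU : Nondeg q U)
    (h : U ≠ ⊥) : ∃ x ∈ U, herm q x x ≠ 0 := by
  by_contra! hc
  apply h
  rw [Submodule.eq_bot_iff]
  intro x hx
  exact hU x hx fun y hy => ti_orth hg hc hx hy

theorem finrank_inf_perp {S : Submodule F (Fin N → F)} {u v : Fin N → F} (hv : v ∈ S)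
    (h : herm q v u ≠ 0) : finrank F ↥(S ⊓ perp q u) + 1 = finrank F S := by
  have h1 := Submodule.finrank_sup_add_finrank_inf_eq (S ⊓ perp q u) (F ∙ v)
  have hv0 : v ≠ 0 := by rintro rfl; exact h (herm_zero_left _)
  have h2 : (S ⊓ perp q u) ⊔ (F ∙ v) = S := by
    apply le_antisymm
    · refine sup_le inf_le_left ?_
      rw [Submodule.span_singleton_le_iff_mem]; exact hv
    · intro x hx
      rw [Submodule.mem_sup]
      refine ⟨x - (herm q x u / herm q v u) • v, ⟨S.sub_mem hx (S.smul_mem _ hv), ?_⟩,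
        (herm q x u / herm q v u) • v, Submodule.smul_mem _ _ (Submodule.mem_span_singleton_self v),
        by simp⟩
      show _ ∈ perp q u
      rw [mem_perp, herm_sub_left, herm_smul_left, div_mul_cancel₀ _ h, sub_self]
  have h3 : (S ⊓ perp q u) ⊓ (F ∙ v) = ⊥ := by
    rw [Submodule.eq_bot_iff]
    rintro x ⟨⟨_, hx⟩, hx2⟩
    obtain ⟨a, rfl⟩ := Submodule.mem_span_singleton.1 hx2
    have hx' := mem_perp.1 hx
    rw [herm_smul_left] at hx'
    rcases mul_eq_zero.1 hx' with h | h'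
    · simp [h]
    · exact absurd h' h
  rw [h2, h3, finrank_span_singleton hv0] at h1
  simp at h1
  omega

theorem finrank_inf_perp_le (S : Submodule F (Fin N → F)) (u : Fin N → F) :
    finrank F S ≤ finrank F ↥(S ⊓ perp q u) + 1 := by
  by_cases h : ∃ v ∈ S, herm q v u ≠ 0
  · obtain ⟨v, hv, h⟩ := h
    exact (finrank_inf_perp hv h).ge
  · push Not at h
    have : S ⊓ perp q u = S := inf_eq_left.2 fun x hx => mem_perp.2 (h x hx)
    rw [this]; omega

/-- Dimension bound for the polar subspace. -/
theorem finrank_inf_polar_le (hg : Good q F) (S : Submodule F (Fin N → F)) :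
    ∀ (m : ℕ) (W : Submodule F (Fin N → F)), finrank F W = m →
    finrank F S ≤ finrank F ↥(S ⊓ polar q W) + m := by
  intro m
  induction m with
  | zero =>
    intro W hW
    rw [Submodule.finrank_eq_zero] at hW
    have : S ⊓ polar q W = S := inf_eq_left.2 fun x _ => mem_polar.2 (by
      intro y hy
      rw [hW, Submodule.mem_bot] at hy
      rw [hy]
      exact herm_zero_symm hg (herm_zero_left _))
    rw [this]; omega
  | succ m ih =>
    intro W hW
    have hne : W ≠ ⊥ := by rintro rfl; simp at hW
    obtain ⟨w, hw, hw0⟩ := Submodule.exists_mem_ne_zero_of_ne_bot hne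
    obtain ⟨y, -, hy⟩ : ∃ y ∈ (⊤ : Submodule F (Fin N → F)), herm q w y ≠ 0 := by
      by_contra! hc
      exact hw0 (nondeg_top hg w trivial hc)
    have h1 := finrank_inf_perp hw hy
    have h2 := ih (W ⊓ perp q y) (by omega)
    have h3 := finrank_inf_perp_le (q := q) (S ⊓ polar q (W ⊓ perp q y)) w
    have h4 : S ⊓ polar q (W ⊓ perp q y) ⊓ perp q w ≤ S ⊓ polar q W := by
      rintro x ⟨⟨hxS, hx⟩, hxw⟩
      refine ⟨hxS, mem_polar.2 ?_⟩
      intro z hz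
      have hxw' := mem_perp.1 hxw
      have h5 := mem_polar.1 hx (z - (herm q z y / herm q w y) • w)
        ⟨W.sub_mem hz (W.smul_mem _ hw), mem_perp.2 (by
          rw [herm_sub_left, herm_smul_left, div_mul_cancel₀ _ hy, sub_self])⟩
      rw [herm_sub_right hg, herm_smul_right, hxw'] at h5
      simpa using h5
    have h5 := Submodule.finrank_mono h4
    omega

/-- A vector outside `W` is not orthogonal to the whole polar of `W`. -/
theorem exists_polar_ne (hg : Good q F) {W : Submodule F (Fin N → F)} {x : Fin N → F}
    (hx : x ∉ W) : ∃ y ∈ polar q W, herm q y x ≠ 0 := by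
  by_contra! hc
  apply hx
  have h1 : (⨅ w : W, LinearMap.ker (hermL q (w : Fin N → F))) ≤ LinearMap.ker (hermL q x) := by
    intro y hy
    exact hc y hy
  have h2 := mem_span_of_iInf_ker_le_ker h1
  have h3 : ∀ L ∈ Submodule.span F (Set.range fun w : W => hermL q (w : Fin N → F)),
      ∃ w ∈ W, L = hermL q w := by
    intro L hL
    induction hL using Submodule.span_induction with
    | mem L h => obtain ⟨w, rfl⟩ := h; exact ⟨w, w.2, rfl⟩
    | zero =>
      refine ⟨0, W.zero_mem, ?_⟩
      refine LinearMap.ext fun y => ?_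
      exact (herm_zero_symm hg (herm_zero_left _)).symm
    | add L L' _ _ h h' =>
      obtain ⟨w, hw, rfl⟩ := h
      obtain ⟨w', hw', rfl⟩ := h'
      refine ⟨w + w', W.add_mem hw hw', ?_⟩
      refine LinearMap.ext fun y => ?_
      exact (herm_add_right hg _ _ _).symm
    | smul a L _ h =>
      obtain ⟨w, hw, rfl⟩ := h
      refine ⟨a ^ q • w, W.smul_mem _ hw, ?_⟩
      refine LinearMap.ext fun y => ?_
      have := herm_smul_right (q := q) (a ^ q) w y
      rw [hg.frob] at this
      exact this.symm
  obtain ⟨w, hw, h4⟩ := h3 _ h2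
  have h5 : x - w = 0 := by
    apply nondeg_top hg _ trivial
    intro y _
    apply herm_zero_symm hg
    rw [herm_sub_right hg]
    have := LinearMap.congr_fun h4 y
    change herm q y x = herm q y w at this
    rw [this, sub_self]
  rw [sub_eq_zero] at h5
  rwa [h5]

end form
section step

variable {q : ℕ} {F : Type} [Field F] [Fintype F] {N : ℕ}

/-- Totally isotropic subspaces of `U` of dimension `m`. -/
def Gen (q : ℕ) {F : Type} [Field F] {N : ℕ} (U : Submodule F (Fin N → F)) (m : ℕ)
    (μ : Submodule F (Fin N → F)) : Prop :=
  μ ≤ U ∧ finrank F μ = m ∧ TotallyIsotropic q μ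

/-- The orthogonal complement of `⟨u, v⟩` in `U`. -/
def red (q : ℕ) {F : Type} [Field F] {N : ℕ} (U : Submodule F (Fin N → F)) (u v : Fin N → F) :
    Submodule F (Fin N → F) := U ⊓ perp q u ⊓ perp q v

variable {U : Submodule F (Fin N → F)} {u v : Fin N → F}

theorem mem_red {x : Fin N → F} :
    x ∈ red q U u v ↔ x ∈ U ∧ herm q x u = 0 ∧ herm q x v = 0 := by
  simp only [red, Submodule.mem_inf, mem_perp, and_assoc]

theorem red_decomp (hu : u ∈ U) (hv : v ∈ U) (huu : herm q u u = 0)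
    (huv : herm q u v ≠ 0) (hvu : herm q v u ≠ 0) {x : Fin N → F} (hx : x ∈ U) :
    ∃ a b : F, ∃ z ∈ red q U u v, x = a • u + b • v + z := by
  refine ⟨herm q (x - (herm q x u / herm q v u) • v) v / herm q u v, herm q x u / herm q v u,
    x - (herm q x u / herm q v u) • v
      - (herm q (x - (herm q x u / herm q v u) • v) v / herm q u v) • u, ?_, by abel⟩
  refine mem_red.2 ⟨U.sub_mem (U.sub_mem hx (U.smul_mem _ hv)) (U.smul_mem _ hu), ?_, ?_⟩
  · rw [herm_sub_left, herm_sub_left, herm_smul_left, herm_smul_left, huu,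
      div_mul_cancel₀ _ hvu]; ring
  · rw [herm_sub_left, herm_smul_left (_ / herm q u v), div_mul_cancel₀ _ huv, sub_self]

theorem red_nondeg (hg : Good q F) (hU : Nondeg q U) (hu : u ∈ U) (hv : v ∈ U)
    (huu : herm q u u = 0) (huv : herm q u v ≠ 0) : Nondeg q (red q U u v) := by
  intro x hx h
  have hx' := mem_red.1 hx
  apply hU x hx'.1
  intro y hy
  obtain ⟨a, b, z, hz, rfl⟩ := red_decomp hu hv huu huv (herm_ne_symm hg huv) hy
  rw [herm_add_right hg, herm_add_right hg, herm_smul_right, herm_smul_right, hx'.2.1, hx'.2.2,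
    h z hz]
  ring

theorem red_finrank (hg : Good q F) (hu : u ∈ U) (hv : v ∈ U)
    (huu : herm q u u = 0) (huv : herm q u v ≠ 0) :
    finrank F ↥(red q U u v) + 2 = finrank F U := by
  have h1 := finrank_inf_perp hv (herm_ne_symm hg huv)
  have h2 := finrank_inf_perp (S := U ⊓ perp q u) ⟨hu, mem_perp.2 huu⟩ huv
  rw [red]
  omega

theorem step_down (hg : Good q F) {m : ℕ} (huv : herm q u v ≠ 0)
    {μ : Submodule F (Fin N → F)} (hμ : Gen q U (m + 1) μ) (huμ : u ∈ μ) :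
    Gen q (red q U u v) m (μ ⊓ perp q v) := by
  refine ⟨?_, ?_, fun x hx => hμ.2.2 x hx.1⟩
  · rintro x ⟨hx, hxv⟩
    exact mem_red.2 ⟨hμ.1 hx, ti_orth hg hμ.2.2 hx huμ, mem_perp.1 hxv⟩
  · have := finrank_inf_perp huμ huv
    have := hμ.2.1
    omega

theorem step_down_up {μ : Submodule F (Fin N → F)} (huv : herm q u v ≠ 0) (huμ : u ∈ μ) :
    (F ∙ u) ⊔ (μ ⊓ perp q v) = μ := by
  apply le_antisymm
  · refine sup_le ?_ inf_le_left
    rwa [Submodule.span_singleton_le_iff_mem]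
  · intro x hx
    rw [Submodule.mem_sup]
    refine ⟨(herm q x v / herm q u v) • u,
      Submodule.smul_mem _ _ (Submodule.mem_span_singleton_self u),
      x - (herm q x v / herm q u v) • u, ⟨μ.sub_mem hx (μ.smul_mem _ huμ), ?_⟩, by abel⟩
    show _ ∈ perp q v
    rw [mem_perp, herm_sub_left, herm_smul_left, div_mul_cancel₀ _ huv, sub_self]

theorem step_up_down {μ : Submodule F (Fin N → F)} (huv : herm q u v ≠ 0)
    (hμ : μ ≤ red q U u v) : ((F ∙ u) ⊔ μ) ⊓ perp q v = μ := by
  apply le_antisymm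
  · rintro x ⟨hx, hxv⟩
    obtain ⟨y, hy, z, hz, rfl⟩ := Submodule.mem_sup.1 hx
    obtain ⟨a, rfl⟩ := Submodule.mem_span_singleton.1 hy
    have h1 := mem_perp.1 hxv
    rw [herm_add_left, herm_smul_left, (mem_red.1 (hμ hz)).2.2, add_zero] at h1
    rcases mul_eq_zero.1 h1 with h | h
    · simpa [h] using hz
    · exact absurd h huv
  · intro x hx
    exact ⟨Submodule.mem_sup_right hx, mem_perp.2 (mem_red.1 (hμ hx)).2.2⟩

theorem step_up (hg : Good q F) {m : ℕ} (hu : u ∈ U) (huu : herm q u u = 0)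
    (huv : herm q u v ≠ 0) {μ : Submodule F (Fin N → F)} (hμ : Gen q (red q U u v) m μ) :
    Gen q U (m + 1) ((F ∙ u) ⊔ μ) := by
  refine ⟨?_, ?_, ?_⟩
  · refine sup_le ?_ fun x hx => (mem_red.1 (hμ.1 hx)).1
    rwa [Submodule.span_singleton_le_iff_mem]
  · have h1 := finrank_inf_perp (S := (F ∙ u) ⊔ μ)
      (Submodule.mem_sup_left (Submodule.mem_span_singleton_self u)) huv
    rw [step_up_down huv hμ.1, hμ.2.1] at h1
    omega
  · intro x hx
    obtain ⟨y, hy, z, hz, rfl⟩ := Submodule.mem_sup.1 hx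
    obtain ⟨a, rfl⟩ := Submodule.mem_span_singleton.1 hy
    have hzu := (mem_red.1 (hμ.1 hz)).2.1
    rw [herm_add_left, herm_add_right hg, herm_add_right hg, herm_smul_left, herm_smul_left,
      herm_smul_right, herm_smul_right, huu, hzu, herm_zero_symm hg hzu, hμ.2.2 z hz]
    ring

theorem step_card (hg : Good q F) {m : ℕ} (hu : u ∈ U) (huu : herm q u u = 0)
    (huv : herm q u v ≠ 0) (Q Q' : Submodule F (Fin N → F) → Prop)
    (hQ : ∀ μ, Gen q U (m + 1) μ → u ∈ μ → (Q μ ↔ Q' (μ ⊓ perp q v))) :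
    Nat.card {μ // Gen q U (m + 1) μ ∧ u ∈ μ ∧ Q μ} =
      Nat.card {μ // Gen q (red q U u v) m μ ∧ Q' μ} := by
  refine Nat.card_congr
    { toFun := fun μ => ⟨μ.1 ⊓ perp q v, step_down hg huv μ.2.1 μ.2.2.1,
        (hQ _ μ.2.1 μ.2.2.1).1 μ.2.2.2⟩
      invFun := fun μ => ⟨(F ∙ u) ⊔ μ.1, step_up hg hu huu huv μ.2.1,
        Submodule.mem_sup_left (Submodule.mem_span_singleton_self u),
        (hQ _ (step_up hg hu huu huv μ.2.1)
          (Submodule.mem_sup_left (Submodule.mem_span_singleton_self u))).2 ?_⟩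
      left_inv := fun μ => Subtype.ext (step_down_up huv μ.2.2.1)
      right_inv := fun μ => Subtype.ext (step_up_down huv μ.2.1.1) }
  rw [step_up_down huv μ.2.1.1]
  exact μ.2.2

/-- Counting complements by the vector in a fixed coset of `A`. -/
theorem sum_card {m K G : ℕ} (c : Fin N → F) (hc : c ∈ U) (A : Submodule F (Fin N → F))
    (hAU : A ≤ U) (hA : finrank F A = m) (hU : finrank F U = 2 * m)
    (hK : Nat.card {u : Fin N → F // u - c ∈ A ∧ herm q u u = 0} = K)
    (hG : ∀ u : Fin N → F, u - c ∈ A → herm q u u = 0 →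
      Nat.card {μ // Gen q U m μ ∧ u ∈ μ ∧ μ ⊓ A = ⊥} = G) :
    Nat.card {μ // Gen q U m μ ∧ μ ⊓ A = ⊥} = K * G := by
  classical
  let S := {u : Fin N → F // u - c ∈ A ∧ herm q u u = 0}
  have hS : Nat.card S = K := hK
  let T : S → Type := fun u => {μ : Submodule F (Fin N → F) // Gen q U m μ ∧ u.1 ∈ μ ∧ μ ⊓ A = ⊥}
  have h1 : Nat.card (Sigma T) = K * G := by
    have : Fintype S := Fintype.ofFinite S
    have hf : ∀ a, Finite (T a) := fun a => by dsimp only [T]; infer_instance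
    rw [Nat.card_sigma, Finset.sum_congr rfl (fun (u : S) _ => hG u.1 u.2.1 u.2.2),
      Finset.sum_const, Finset.card_univ, ← Nat.card_eq_fintype_card, hS, smul_eq_mul]
  rw [← h1]
  symm
  refine Nat.card_eq_of_bijective
    (fun x : Sigma T => (⟨x.2.1, x.2.2.1, x.2.2.2.2⟩ : {μ // Gen q U m μ ∧ μ ⊓ A = ⊥})) ⟨?_, ?_⟩
  · rintro ⟨⟨u, hu1, hu2⟩, ⟨μ, hμ⟩⟩ ⟨⟨u', hu1', hu2'⟩, ⟨μ', hμ'⟩⟩ h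
    have h2 : μ = μ' := congrArg Subtype.val h
    subst h2
    have h3 : u - u' ∈ μ ⊓ A := by
      refine ⟨μ.sub_mem hμ.2.1 hμ'.2.1, ?_⟩
      have : u - u' = (u - c) - (u' - c) := by abel
      rw [this]
      exact A.sub_mem hu1 hu1'
    rw [hμ.2.2, Submodule.mem_bot, sub_eq_zero] at h3
    subst h3
    rfl
  · rintro ⟨μ, hμ, hμA⟩
    have h2 := Submodule.finrank_sup_add_finrank_inf_eq μ A
    rw [hμA, hμ.2.1, hA, finrank_bot] at h2
    have h3 : μ ⊔ A = U :=
      Submodule.eq_of_le_of_finrank_eq (sup_le hμ.1 hAU) (by omega)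
    rw [← h3] at hc
    obtain ⟨x, hx, a, ha, hxa⟩ := Submodule.mem_sup.1 hc
    refine ⟨⟨⟨x, ?_, hμ.2.2 x hx⟩, ⟨μ, hμ, hx, hμA⟩⟩, rfl⟩
    rw [← hxa]
    simpa using ha

end step

section count

variable {q : ℕ} {F : Type} [Field F] [Fintype F] {N : ℕ}

theorem norm_vec_rec (hg : Good q F) (A : Submodule F (Fin N → F)) (e : Fin N → F) (he : e ∈ A)
    (hee : herm q e e ≠ 0) (k : F) (hk : k ^ q = k) (m : ℕ) (hA : finrank F A = m + 1) :
    Nat.card {a : Fin N → F // a ∈ A ∧ herm q a a = k} +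
      q * Nat.card {a : Fin N → F // a ∈ A ⊓ perp q e ∧ herm q a a = k} =
      (q + 1) * q ^ (2 * m) := by
  classical
  have hA' : finrank F ↥(A ⊓ perp q e) = m := by
    have := finrank_inf_perp he hee; omega
  let B : Submodule F (Fin N → F) := A ⊓ perp q e
  let T : B → Type := fun b => {x : F // x * x ^ q * herm q e e + herm q b.1 b.1 = k}
  have hcard : Fintype.card B = q ^ (2 * m) := by
    rw [Module.card_eq_pow_finrank (K := F), hg.card, show finrank F B = m from hA', pow_mul]
  have hbij : Nat.card (Sigma T) = Nat.card {a : Fin N → F // a ∈ A ∧ herm q a a = k} := by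
    have key : ∀ (x : F) (b : B), herm q (x • e + b.1) (x • e + b.1) =
        x * x ^ q * herm q e e + herm q b.1 b.1 := by
      intro x b
      have hb := mem_perp.1 b.2.2
      rw [herm_add_left, herm_add_right hg, herm_add_right hg, herm_smul_left, herm_smul_left,
        herm_smul_right, herm_smul_right, hb, herm_zero_symm hg hb]
      ring
    refine Nat.card_eq_of_bijective (fun z => ⟨z.2.1 • e + z.1.1,
      A.add_mem (A.smul_mem _ he) z.1.2.1, by rw [key]; exact z.2.2⟩) ⟨?_, ?_⟩
    · rintro ⟨⟨b, hb⟩, ⟨x, hx⟩⟩ ⟨⟨b', hb'⟩, ⟨x', hx'⟩⟩ h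
      have h2 : x • e + b = x' • e + b' := congrArg Subtype.val h
      have h3 := congrArg (fun y => herm q y e) h2
      simp only [herm_add_left, herm_smul_left, mem_perp.1 hb.2, mem_perp.1 hb'.2, add_zero] at h3
      have h4 := mul_right_cancel₀ hee h3
      subst h4
      have h5 := add_left_cancel h2
      subst h5
      rfl
    · rintro ⟨a, ha, hak⟩
      let x := herm q a e / herm q e e
      let b : B := ⟨a - x • e, A.sub_mem ha (A.smul_mem _ he), mem_perp.2 (by
        rw [herm_sub_left, herm_smul_left, div_mul_cancel₀ _ hee, sub_self])⟩
      have hab : x • e + b.1 = a := by simp [b]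
      refine ⟨⟨b, ⟨x, ?_⟩⟩, Subtype.ext hab⟩
      rw [← key, hab, hak]
  have hT : ∀ b : B, Nat.card (T b) + (if herm q b.1 b.1 = k then q else 0) = q + 1 := by
    intro b
    by_cases h : herm q b.1 b.1 = k
    · rw [if_pos h]
      have : Nat.card (T b) = 1 := by
        rw [Nat.card_eq_one_iff_unique]
        refine ⟨⟨?_⟩, ⟨⟨0, by simp [h]⟩⟩⟩
        have hz : ∀ x : F, x * x ^ q * herm q e e + herm q b.1 b.1 = k → x = 0 := by
          intro x hx
          rw [h, add_eq_right, mul_eq_zero, or_iff_left hee, ← pow_succ'] at hx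
          exact pow_eq_zero_iff (by omega) |>.1 hx
        rintro ⟨x, hx⟩ ⟨y, hy⟩
        exact Subtype.ext ((hz x hx).trans (hz y hy).symm)
      rw [this]; omega
    · rw [if_neg h, add_zero]
      have hne : (k - herm q b.1 b.1) / herm q e e ≠ 0 :=
        div_ne_zero (sub_ne_zero.2 (Ne.symm h)) hee
      rw [← norm_count hg ((k - herm q b.1 b.1) / herm q e e) (by
        rw [div_pow, herm_self hg, sub_eq_add_neg, hg.add, frob_neg hg, herm_self hg, hk]) hne]
      refine Nat.card_congr (Equiv.subtypeEquivRight fun x => ?_)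
      rw [eq_div_iff hee, eq_sub_iff_add_eq]
  have hsum : Nat.card (Sigma T) + ∑ b : B, (if herm q b.1 b.1 = k then q else 0) =
      (q + 1) * q ^ (2 * m) := by
    have hf : ∀ a, Finite (T a) := fun a => by dsimp only [T]; infer_instance
    rw [Nat.card_sigma, ← Finset.sum_add_distrib, Finset.sum_congr rfl (fun b _ => hT b),
      Finset.sum_const, Finset.card_univ, hcard, smul_eq_mul, mul_comm]
  rw [← hbij, ← hsum]
  congr 1
  rw [← Finset.sum_filter, Finset.sum_const, smul_eq_mul, mul_comm]
  congr 1
  rw [← Fintype.card_subtype, ← Nat.card_eq_fintype_card]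
  exact Nat.card_congr
    { toFun := fun a => ⟨⟨a.1, a.2.1⟩, a.2.2⟩
      invFun := fun a => ⟨a.1.1, a.1.2, a.2⟩
      left_inv := fun _ => rfl
      right_inv := fun _ => rfl }

theorem norm_vec_count (hg : Good q F) (k : F) (hk : k ^ q = k) (hk0 : k ≠ 0) :
    ∀ (m : ℕ) (A : Submodule F (Fin N → F)), finrank F A = m → Nondeg q A →
    (q : ℤ) * Nat.card {a : Fin N → F // a ∈ A ∧ herm q a a = k} = q ^ (2 * m) - (-q) ^ m := by
  intro m
  induction m with
  | zero =>
    intro A hA _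
    rw [Submodule.finrank_eq_zero] at hA
    have : IsEmpty {a : Fin N → F // a ∈ A ∧ herm q a a = k} := by
      refine ⟨?_⟩
      rintro ⟨a, ha, hak⟩
      rw [hA, Submodule.mem_bot] at ha
      rw [ha, herm_zero_left] at hak
      exact hk0 hak.symm
    simp
  | succ m ih =>
    intro A hA hnd
    have hne : A ≠ ⊥ := by rintro rfl; simp at hA
    obtain ⟨e, he, hee⟩ := exists_aniso hg hnd hne
    have h1 := norm_vec_rec hg A e he hee k hk m hA
    have h2 := ih (A ⊓ perp q e) (by have := finrank_inf_perp he hee; omega) (by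
      intro x hx h
      apply hnd x hx.1
      intro y hy
      have h3 := h (y - (herm q y e / herm q e e) • e)
        ⟨A.sub_mem hy (A.smul_mem _ he), mem_perp.2 (by
          rw [herm_sub_left, herm_smul_left, div_mul_cancel₀ _ hee, sub_self])⟩
      rw [herm_sub_right hg, herm_smul_right, mem_perp.1 hx.2] at h3
      simpa using h3)
    have h3 : ((Nat.card {a : Fin N → F // a ∈ A ∧ herm q a a = k} : ℕ) : ℤ) +
      q * (Nat.card {a : Fin N → F // a ∈ A ⊓ perp q e ∧ herm q a a = k} : ℕ) =
      (q + 1) * q ^ (2 * m) := by exact_mod_cast h1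
    rw [h2] at h3
    have h4 : ((Nat.card {a : Fin N → F // a ∈ A ∧ herm q a a = k} : ℕ) : ℤ) =
      (q + 1) * q ^ (2 * m) - (q ^ (2 * m) - (-q) ^ m) := by linarith
    rw [h4]
    ring

/-- Isotropic vectors in a coset. -/
theorem coset_count (hg : Good q F) (A : Submodule F (Fin N → F)) (c ρ : Fin N → F)
    (hρ : ρ ∈ A) (hρA : ∀ a ∈ A, herm q a ρ = 0) (hc : herm q ρ c ≠ 0) (m : ℕ)
    (hA : finrank F A = m) :
    q * Nat.card {u : Fin N → F // u - c ∈ A ∧ herm q u u = 0} = q ^ (2 * m) := by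
  classical
  let S := {u : Fin N → F // u - c ∈ A ∧ herm q u u = 0}
  let T : A → Type := fun a => {t : F // herm q (c + a.1 + t • ρ) (c + a.1 + t • ρ) = 0}
  have hcard : Fintype.card A = q ^ (2 * m) := by
    rw [Module.card_eq_pow_finrank (K := F), hg.card, hA, pow_mul]
  have h1 : Nat.card (Sigma T) = Nat.card (S × F) := by
    refine Nat.card_congr
      { toFun := fun z => ⟨⟨c + z.1.1 + z.2.1 • ρ, ?_, z.2.2⟩, z.2.1⟩
        invFun := fun z => ⟨⟨z.1.1 - c - z.2 • ρ, A.sub_mem z.1.2.1 (A.smul_mem _ hρ)⟩, ⟨z.2, ?_⟩⟩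
        left_inv := ?_
        right_inv := ?_ }
    · have : c + z.1.1 + z.2.1 • ρ - c = z.1.1 + z.2.1 • ρ := by abel
      rw [this]
      exact A.add_mem z.1.2 (A.smul_mem _ hρ)
    · have : c + (z.1.1 - c - z.2 • ρ) + z.2 • ρ = z.1.1 := by abel
      simp only [this]
      exact z.1.2.2
    · rintro ⟨⟨a, ha⟩, ⟨t, ht⟩⟩
      have h0 : c + a + t • ρ - c - t • ρ = a := by abel
      have h1 : ∀ (b : Fin N → F) (hb : b ∈ A)
          (hb' : herm q (c + b + t • ρ) (c + b + t • ρ) = 0), b = a →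
          (⟨⟨b, hb⟩, ⟨t, hb'⟩⟩ : Sigma T) = ⟨⟨a, ha⟩, ⟨t, ht⟩⟩ := by
        intro b hb hb' h
        subst h
        rfl
      exact h1 _ _ _ h0
    · rintro ⟨⟨u, hu, hu'⟩, t⟩
      have : c + (u - c - t • ρ) + t • ρ = u := by abel
      simp only [this]
  have hT : ∀ a : A, Nat.card (T a) = q := by
    intro a
    have hw : herm q ρ (c + a.1) ≠ 0 := by
      rw [herm_add_right hg, herm_zero_symm hg (hρA _ a.2), add_zero]; exact hc
    rw [← trace_count hg (-(herm q (c + a.1) (c + a.1))) (by rw [frob_neg hg, herm_self hg])]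
    have key : ∀ t : F, herm q (c + a.1 + t • ρ) (c + a.1 + t • ρ) =
        herm q (c + a.1) (c + a.1) + (t * herm q ρ (c + a.1) + (t * herm q ρ (c + a.1)) ^ q) := by
      intro t
      rw [herm_add_left, herm_add_right hg (c + a.1), herm_add_right hg (c + a.1), herm_smul_left,
        herm_smul_left, herm_smul_right, herm_smul_right, hρA ρ hρ,
        herm_symm hg ρ (c + a.1), mul_pow]
      ring
    refine Nat.card_congr
      { toFun := fun t => ⟨t.1 * herm q ρ (c + a.1), ?_⟩
        invFun := fun t => ⟨t.1 / herm q ρ (c + a.1), ?_⟩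
        left_inv := fun t => Subtype.ext (mul_div_cancel_right₀ _ hw)
        right_inv := fun t => Subtype.ext (div_mul_cancel₀ _ hw) }
    · have h := t.2
      rw [key] at h
      exact (neg_eq_of_add_eq_zero_right h).symm
    · rw [key, div_mul_cancel₀ _ hw, t.2, add_neg_cancel]
  have hf : ∀ a, Finite (T a) := fun a => by dsimp only [T]; infer_instance
  rw [Nat.card_sigma, Finset.sum_congr rfl (fun a _ => hT a), Finset.sum_const, Finset.card_univ,
    hcard, smul_eq_mul, Nat.card_prod, Nat.card_eq_fintype_card (α := F), hg.card] at h1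
  have h0 : 0 < q := by have := hg.two_le; omega
  apply Nat.eq_of_mul_eq_mul_left h0
  rw [mul_comm q (q ^ (2 * m)), h1]
  ring

end count
section main

variable {q : ℕ} {F : Type} [Field F] [Fintype F] {N : ℕ}

/-- The condition `μ ∩ A = 0` passes to the reduced space. -/
theorem inf_bot_iff (hg : Good q F) {μ A : Submodule F (Fin N → F)} {u v : Fin N → F}
    (hμ : TotallyIsotropic q μ) (hu : u ∈ μ) (h : ∀ a ∈ A, herm q a u = 0 → herm q a v = 0) :
    μ ⊓ A = ⊥ ↔ (μ ⊓ perp q v) ⊓ (A ⊓ perp q u) = ⊥ := by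
  have : μ ⊓ A = (μ ⊓ perp q v) ⊓ (A ⊓ perp q u) := by
    apply le_antisymm
    · rintro x ⟨hx, hxA⟩
      have hxu := ti_orth hg hμ hx hu
      exact ⟨⟨hx, mem_perp.2 (h x hxA hxu)⟩, hxA, mem_perp.2 hxu⟩
    · rintro x ⟨⟨hx, _⟩, hxA, _⟩
      exact ⟨hx, hxA⟩
  rw [this]

/-- One step of the recursion. -/
theorem main_step (hg : Good q F) {m : ℕ} {U A : Submodule F (Fin N → F)}
    {u v : Fin N → F} (hu : u ∈ U) (huu : herm q u u = 0) (huv : herm q u v ≠ 0)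
    (h : ∀ a ∈ A, herm q a u = 0 → herm q a v = 0) :
    Nat.card {μ // Gen q U (m + 1) μ ∧ u ∈ μ ∧ μ ⊓ A = ⊥} =
      Nat.card {μ // Gen q (red q U u v) m μ ∧ μ ⊓ (A ⊓ perp q u) = ⊥} :=
  step_card hg hu huu huv _ _ fun _ hμ huμ => inf_bot_iff hg hμ.2.2 huμ h

theorem red_le {U A : Submodule F (Fin N → F)} (hAU : A ≤ U) {u v : Fin N → F}
    (h : ∀ a ∈ A, herm q a u = 0 → herm q a v = 0) : A ⊓ perp q u ≤ red q U u v := by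
  rintro x ⟨hx, hxu⟩
  exact mem_red.2 ⟨hAU hx, mem_perp.1 hxu, h x hx (mem_perp.1 hxu)⟩

/-- Complements of a nondegenerate subspace. -/
theorem main_nondeg (hg : Good q F) : ∀ (s : ℕ) (U A : Submodule F (Fin N → F)), A ≤ U →
    Nondeg q U → finrank F U = 2 * s → finrank F A = s → Nondeg q A →
    ((Nat.card {μ // Gen q U s μ ∧ μ ⊓ A = ⊥} : ℕ) : ℤ) =
      ∏ j ∈ Finset.range s, (q : ℤ) ^ j * ((q : ℤ) ^ (j + 1) - (-1) ^ (j + 1)) := by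
  intro s
  induction s with
  | zero =>
    intro U A _ _ hU _ _
    have : Nat.card {μ // Gen q U 0 μ ∧ μ ⊓ A = ⊥} = 1 := by
      rw [Nat.card_eq_one_iff_unique]
      refine ⟨⟨?_⟩, ⟨⟨⊥, ⟨bot_le, by simp, ?_⟩, by simp⟩⟩⟩
      · rintro ⟨μ, hμ, _⟩ ⟨ν, hν, _⟩
        have h1 := Submodule.finrank_eq_zero.1 hμ.2.1
        have h2 := Submodule.finrank_eq_zero.1 hν.2.1
        exact Subtype.ext (h1.trans h2.symm)
      · intro x hx
        rw [Submodule.mem_bot] at hx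
        rw [hx, herm_zero_left]
    simp [this]
  | succ s ih =>
    intro U A hAU hUnd hU hA hAnd
    -- the orthogonal complement of `A` in `U`
    have hdisj : A ⊓ (U ⊓ polar q A) = ⊥ := by
      rw [Submodule.eq_bot_iff]
      rintro x ⟨hx, _, hx'⟩
      exact hAnd x hx (mem_polar.1 hx')
    have hdim := finrank_inf_polar_le hg U (s + 1) A hA
    have hsup : A ⊔ (U ⊓ polar q A) = U := by
      refine Submodule.eq_of_le_of_finrank_le (sup_le hAU inf_le_left) ?_
      have := Submodule.finrank_sup_add_finrank_inf_eq A (U ⊓ polar q A)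
      rw [hdisj, finrank_bot] at this
      omega
    have hBnd : Nondeg q (U ⊓ polar q A) := by
      intro x hx h
      apply hUnd x hx.1
      intro y hy
      rw [← hsup] at hy
      obtain ⟨a, ha, b, hb, rfl⟩ := Submodule.mem_sup.1 hy
      rw [herm_add_right hg, h b hb, mem_polar.1 hx.2 a ha, add_zero]
    have hBne : U ⊓ polar q A ≠ ⊥ := by
      intro h
      rw [h, finrank_bot] at hdim
      omega
    obtain ⟨c, hc, hcc⟩ := exists_aniso hg hBnd hBne
    have hcA := mem_polar.1 hc.2
    have hexp : ∀ a ∈ A, herm q (c + a) (c + a) = herm q c c + herm q a a := by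
      intro a ha
      rw [herm_add_left, herm_add_right hg, herm_add_right hg, hcA a ha,
        herm_zero_symm hg (hcA a ha)]
      ring
    have hK : Nat.card {u : Fin N → F // u - c ∈ A ∧ herm q u u = 0} =
        Nat.card {a : Fin N → F // a ∈ A ∧ herm q a a = - herm q c c} := by
      refine Nat.card_congr
        { toFun := fun u => ⟨u.1 - c, u.2.1, ?_⟩
          invFun := fun a => ⟨c + a.1, by simpa using a.2.1, ?_⟩
          left_inv := fun u => Subtype.ext (by simp)
          right_inv := fun u => Subtype.ext (by simp) }
      · have h := hexp _ u.2.1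
        rw [add_sub_cancel, u.2.2] at h
        exact (neg_eq_of_add_eq_zero_right h.symm).symm
      · rw [hexp _ a.2.1, a.2.2, add_neg_cancel]
    have hcnt := norm_vec_count hg (- herm q c c) (by rw [frob_neg hg, herm_self hg])
      (neg_ne_zero.2 hcc) (s + 1) A hA hAnd
    let G := (∏ j ∈ Finset.range s, (q : ℤ) ^ j * ((q : ℤ) ^ (j + 1) - (-1) ^ (j + 1))).toNat
    have hG : ∀ u : Fin N → F, u - c ∈ A → herm q u u = 0 →
        ((Nat.card {μ // Gen q U (s + 1) μ ∧ u ∈ μ ∧ μ ⊓ A = ⊥} : ℕ) : ℤ) =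
        ∏ j ∈ Finset.range s, (q : ℤ) ^ j * ((q : ℤ) ^ (j + 1) - (-1) ^ (j + 1)) := by
      intro u hu huu
      have huU : u ∈ U := by
        have := U.add_mem hc.1 (hAU hu)
        rwa [add_sub_cancel] at this
      have heq := hexp _ hu
      rw [add_sub_cancel, huu] at heq
      have hvv : herm q (u - c) (u - c) ≠ 0 := by
        intro h
        rw [h, add_zero] at heq
        exact hcc heq.symm
      have hav : ∀ a ∈ A, herm q a (u - c) = herm q a u := by
        intro a ha
        rw [herm_sub_right hg, herm_zero_symm hg (hcA a ha), sub_zero]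
      have huv : herm q u (u - c) ≠ 0 := by
        apply herm_ne_symm hg
        rw [← hav _ hu]
        exact hvv
      have himp : ∀ a ∈ A, herm q a u = 0 → herm q a (u - c) = 0 := by
        intro a ha h
        rw [hav a ha, h]
      rw [main_step hg huU huu huv himp]
      apply ih _ _ (red_le hAU himp) (red_nondeg hg hUnd huU (hAU hu) huu huv)
      · have := red_finrank hg huU (hAU hu) huu huv
        omega
      · have := finrank_inf_perp hu (herm_ne_symm hg huv)
        omega
      · intro x hx h
        apply hAnd x hx.1
        intro y hy
        have hvu := herm_ne_symm hg huv
        have h3 := h (y - (herm q y u / herm q (u - c) u) • (u - c))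
          ⟨A.sub_mem hy (A.smul_mem _ hu), mem_perp.2 (by
            rw [herm_sub_left, herm_smul_left, div_mul_cancel₀ _ hvu, sub_self])⟩
        rw [herm_sub_right hg, herm_smul_right, himp x hx.1 (mem_perp.1 hx.2)] at h3
        simpa using h3
    have hG' : ∀ u : Fin N → F, u - c ∈ A → herm q u u = 0 →
        Nat.card {μ // Gen q U (s + 1) μ ∧ u ∈ μ ∧ μ ⊓ A = ⊥} = G := by
      intro u hu huu
      have := hG u hu huu
      simp only [G]
      rw [← this]
      simp
    have hfin := sum_card c hc.1 A hAU hA hU rfl hG'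
    have hq0 : (q : ℤ) ≠ 0 := by have := hg.two_le; positivity
    by_cases hem : IsEmpty {u : Fin N → F // u - c ∈ A ∧ herm q u u = 0}
    · rw [hK] at hfin
      have h0 : Nat.card {a : Fin N → F // a ∈ A ∧ herm q a a = - herm q c c} = 0 := by
        rw [← hK]; simp
      rw [h0] at hcnt
      rw [hfin, h0, Finset.prod_range_succ]
      have : (q : ℤ) ^ (s + 1) - (-1) ^ (s + 1) = 0 := by
        have h5 : (q : ℤ) ^ (s + 1) * ((q : ℤ) ^ (s + 1) - (-1) ^ (s + 1)) = 0 := by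
          have h6 : (q : ℤ) ^ (s + 1) * ((q : ℤ) ^ (s + 1) - (-1) ^ (s + 1)) =
              (q : ℤ) ^ (2 * (s + 1)) - (-q) ^ (s + 1) := by
            rw [neg_pow (q : ℤ)]; ring
          rw [h6, ← hcnt]; simp
        exact (mul_eq_zero.1 h5).resolve_left (pow_ne_zero _ hq0)
      rw [this]; simp
    · rw [not_isEmpty_iff] at hem
      obtain ⟨u, hu, huu⟩ := hem
      have hGG := hG u hu huu
      rw [hG' u hu huu] at hGG
      rw [hfin, hK]
      push_cast
      rw [hGG, Finset.prod_range_succ, mul_comm]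
      congr 1
      apply mul_left_cancel₀ hq0
      rw [hcnt, neg_pow]
      ring

/-- Complements of a general subspace. -/
theorem main_gen (hg : Good q F) (s : ℕ) : ∀ (r : ℕ) (U A : Submodule F (Fin N → F)), A ≤ U →
    Nondeg q U → finrank F U = 2 * (r + s) → finrank F A = r + s →
    finrank F ↥(A ⊓ polar q A) = r →
    ((Nat.card {μ // Gen q U (r + s) μ ∧ μ ⊓ A = ⊥} : ℕ) : ℤ) = (q : ℤ) ^ (r ^ 2 + 2 * r * s) *
      ∏ j ∈ Finset.range s, (q : ℤ) ^ j * ((q : ℤ) ^ (j + 1) - (-1) ^ (j + 1)) := by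
  intro r
  induction r with
  | zero =>
    intro U A hAU hUnd hU hA hR
    rw [Submodule.finrank_eq_zero] at hR
    have := main_nondeg hg s U A hAU hUnd (by omega) (by omega) (by
      intro x hx h
      have : x ∈ A ⊓ polar q A := ⟨hx, mem_polar.2 h⟩
      rwa [hR, Submodule.mem_bot] at this)
    simp only [zero_add]
    rw [this]
    simp
  | succ r ih =>
    intro U A hAU hUnd hU hA hR
    have hne : A ⊓ polar q A ≠ ⊥ := by intro h; rw [h, finrank_bot] at hR; omega
    obtain ⟨ρ, hρ, hρ0⟩ := Submodule.exists_mem_ne_zero_of_ne_bot hne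
    have hρA := mem_polar.1 hρ.2
    obtain ⟨c, hc, hρc⟩ : ∃ c ∈ U, herm q ρ c ≠ 0 := by
      by_contra! h
      exact hρ0 (hUnd ρ (hAU hρ.1) h)
    have hK := coset_count hg A c ρ hρ.1 (fun a ha => herm_zero_symm hg (hρA a ha)) hρc _ hA
    let G := ((q : ℤ) ^ (r ^ 2 + 2 * r * s) *
      ∏ j ∈ Finset.range s, (q : ℤ) ^ j * ((q : ℤ) ^ (j + 1) - (-1) ^ (j + 1))).toNat
    have hG : ∀ u : Fin N → F, u - c ∈ A → herm q u u = 0 →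
        ((Nat.card {μ // Gen q U (r + 1 + s) μ ∧ u ∈ μ ∧ μ ⊓ A = ⊥} : ℕ) : ℤ) =
        (q : ℤ) ^ (r ^ 2 + 2 * r * s) *
        ∏ j ∈ Finset.range s, (q : ℤ) ^ j * ((q : ℤ) ^ (j + 1) - (-1) ^ (j + 1)) := by
      intro u hu huu
      have huU : u ∈ U := by
        have := U.add_mem hc (hAU hu)
        rwa [add_sub_cancel] at this
      have hρu : herm q ρ u ≠ 0 := by
        have : herm q ρ (c + (u - c)) ≠ 0 := by
          rw [herm_add_right hg, hρA _ hu, add_zero]; exact hρc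
        rwa [add_sub_cancel] at this
      have huρ := herm_ne_symm hg hρu
      have himp : ∀ a ∈ A, herm q a u = 0 → herm q a ρ = 0 := fun a ha _ =>
        herm_zero_symm hg (hρA a ha)
      rw [show r + 1 + s = (r + s) + 1 by omega, main_step hg huU huu huρ himp]
      apply ih _ _ (red_le hAU himp) (red_nondeg hg hUnd huU (hAU hρ.1) huu huρ)
      · have := red_finrank hg huU (hAU hρ.1) huu huρ
        omega
      · have := finrank_inf_perp hρ.1 hρu
        omega
      · have h1 := finrank_inf_perp hρ hρu
        have h2 : A ⊓ perp q u ⊓ polar q (A ⊓ perp q u) = A ⊓ polar q A ⊓ perp q u := by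
          apply le_antisymm
          · rintro x ⟨⟨hx, hxu⟩, hx'⟩
            refine ⟨⟨hx, mem_polar.2 fun y hy => ?_⟩, hxu⟩
            have h3 := mem_polar.1 hx' (y - (herm q y u / herm q ρ u) • ρ)
              ⟨A.sub_mem hy (A.smul_mem _ hρ.1), mem_perp.2 (by
                rw [herm_sub_left, herm_smul_left, div_mul_cancel₀ _ hρu, sub_self])⟩
            rw [herm_sub_right hg, herm_smul_right, himp x hx (mem_perp.1 hxu)] at h3
            simpa using h3
          · rintro x ⟨⟨hx, hx'⟩, hxu⟩
            exact ⟨⟨hx, hxu⟩, mem_polar.2 fun y hy => mem_polar.1 hx' y hy.1⟩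
        rw [h2]
        omega
    have hG' : ∀ u : Fin N → F, u - c ∈ A → herm q u u = 0 →
        Nat.card {μ // Gen q U (r + 1 + s) μ ∧ u ∈ μ ∧ μ ⊓ A = ⊥} = G := by
      intro u hu huu
      have := hG u hu huu
      simp only [G]
      rw [← this]
      simp
    have hfin := sum_card c hc A hAU hA hU rfl hG'
    have h0 : 0 < q := by have := hg.two_le; omega
    have hq0 : (q : ℤ) ≠ 0 := by positivity
    have hpos : 0 < Nat.card {u : Fin N → F // u - c ∈ A ∧ herm q u u = 0} := by
      rcases Nat.eq_zero_or_pos (Nat.card {u : Fin N → F // u - c ∈ A ∧ herm q u u = 0}) with h | h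
      · rw [h, mul_zero] at hK
        exact absurd hK.symm (pow_ne_zero _ h0.ne')
      · exact h
    obtain ⟨⟨u, hu, huu⟩⟩ := (Nat.card_pos_iff.1 hpos).1
    have hGG := hG u hu huu
    rw [hG' u hu huu] at hGG
    rw [hfin]
    have hK' : (q : ℤ) * (Nat.card {u : Fin N → F // u - c ∈ A ∧ herm q u u = 0} : ℕ) =
      (q : ℤ) ^ (2 * (r + 1 + s)) := by exact_mod_cast hK
    apply mul_left_cancel₀ hq0
    push_cast
    rw [hGG, ← mul_assoc, hK']
    ring

end main
section final

variable {q : ℕ} {F : Type} [Field F] [Fintype F] {N : ℕ}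

theorem exists_span {P : Submodule F (Fin N → F)} (h : finrank F P = 1) :
    ∃ p, p ≠ 0 ∧ P = F ∙ p := by
  have hne : P ≠ ⊥ := by rintro rfl; simp at h
  obtain ⟨p, hp, hp0⟩ := Submodule.exists_mem_ne_zero_of_ne_bot hne
  refine ⟨p, hp0, (Submodule.eq_of_le_of_finrank_eq ?_ ?_).symm⟩
  · rwa [Submodule.span_singleton_le_iff_mem]
  · rw [finrank_span_singleton hp0, h]

/-- The geometric reduction. -/
theorem reduction (hg : Good q F) {m r : ℕ} (π : Submodule F (Fin N → F))
    (hN : N = 2 * m + 4) (hπ : finrank F π = m + 2) (hR : finrank F ↥(π ⊓ polar q π) = r)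
    (p p' : Fin N → F) (hpp : herm q p p = 0) (hp'p' : herm q p' p' = 0)
    (hpπ : p ∈ π) (hpσ : p ∉ polar q π) (hp'σ : p' ∈ polar q π) (hp'π : p' ∉ π) :
    ∃ U A : Submodule F (Fin N → F), A ≤ U ∧ Nondeg q U ∧ finrank F U = 2 * m ∧
      finrank F A = m ∧ finrank F ↥(A ⊓ polar q A) = r ∧
      Nat.card {μ : Submodule F (Fin N → F) // Gen q ⊤ (m + 2) μ ∧ p ∈ μ ∧
        (μ ⊓ π = F ∙ p ∧ μ ⊓ polar q π = F ∙ p')} =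
      Nat.card {μ // Gen q U m μ ∧ μ ⊓ A = ⊥} := by
  obtain ⟨p₂, hp₂, hpp₂⟩ : ∃ y ∈ π, herm q p y ≠ 0 := by
    by_contra! h
    exact hpσ (mem_polar.2 h)
  obtain ⟨t, ht, htp⟩ := exists_polar_ne hg hp'π
  have hpt := herm_ne_symm hg htp
  have hσ : ∀ x ∈ polar q π, ∀ y ∈ π, herm q x y = 0 := fun x hx => mem_polar.1 hx
  have hσ' : ∀ x ∈ polar q π, ∀ y ∈ π, herm q y x = 0 := fun x hx y hy =>
    herm_zero_symm hg (hσ x hx y hy)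
  let U₁ := red q (⊤ : Submodule F (Fin N → F)) p p₂
  have hσU : ∀ x ∈ polar q π, x ∈ U₁ := fun x hx =>
    mem_red.2 ⟨trivial, hσ x hx _ hpπ, hσ x hx _ hp₂⟩
  have hU₁ : Nondeg q U₁ := red_nondeg hg (nondeg_top hg) trivial trivial hpp hpp₂
  have hU₁d : finrank F U₁ = 2 * m + 2 := by
    have := red_finrank hg (U := ⊤) (u := p) (v := p₂) trivial trivial hpp hpp₂
    rw [finrank_top, Module.finrank_fin_fun] at this
    change finrank F U₁ + 2 = N at this
    omega
  let U := red q U₁ p' t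
  let A := red q π p p₂
  have hUnd : Nondeg q U := red_nondeg hg hU₁ (hσU _ hp'σ) (hσU _ ht) hp'p' hpt
  have hUd : finrank F U = 2 * m := by
    have := red_finrank hg (hσU _ hp'σ) (hσU _ ht) hp'p' hpt
    change finrank F U + 2 = _ at this
    omega
  have hAπ : A ≤ π := fun x hx => (mem_red.1 hx).1
  have hAd : finrank F A = m := by
    have := red_finrank hg hpπ hp₂ hpp hpp₂
    change finrank F A + 2 = _ at this
    omega
  have hAU : A ≤ U := by
    intro x hx
    have hx' := mem_red.1 hx
    exact mem_red.2 ⟨mem_red.2 ⟨trivial, hx'.2⟩, hσ' _ hp'σ _ hx'.1, hσ' _ ht _ hx'.1⟩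
  refine ⟨U, A, hAU, hUnd, hUd, hAd, ?_, ?_⟩
  · have : A ⊓ polar q A = π ⊓ polar q π := by
      apply le_antisymm
      · rintro x ⟨hx, hx'⟩
        refine ⟨hAπ hx, mem_polar.2 fun y hy => ?_⟩
        obtain ⟨a, b, z, hz, rfl⟩ := red_decomp hpπ hp₂ hpp hpp₂ (herm_ne_symm hg hpp₂) hy
        have hx2 := mem_red.1 hx
        rw [herm_add_right hg, herm_add_right hg, herm_smul_right, herm_smul_right, hx2.2.1,
          hx2.2.2, mem_polar.1 hx' z hz]
        ring
      · rintro x ⟨hx, hx'⟩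
        exact ⟨mem_red.2 ⟨hx, hσ x hx' _ hpπ, hσ x hx' _ hp₂⟩,
          mem_polar.2 fun y hy => hσ x hx' y (hAπ hy)⟩
    rw [this, hR]
  · have h1 := step_card (m := m + 1) (U := ⊤) (v := p₂) hg trivial hpp hpp₂
      (fun μ => μ ⊓ π = F ∙ p ∧ μ ⊓ polar q π = F ∙ p')
      (fun μ => p' ∈ μ ∧ (μ ⊓ π = ⊥ ∧ μ ⊓ polar q π = F ∙ p')) (by
        intro μ hμ hpμ
        have e1 : μ ⊓ perp q p₂ ⊓ polar q π = μ ⊓ polar q π := by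
          apply le_antisymm
          · rintro x ⟨⟨hx, _⟩, hx'⟩
            exact ⟨hx, hx'⟩
          · rintro x ⟨hx, hx'⟩
            exact ⟨⟨hx, mem_perp.2 (hσ x hx' _ hp₂)⟩, hx'⟩
        have e2 : μ ⊓ π = F ∙ p ↔ μ ⊓ perp q p₂ ⊓ π = ⊥ := by
          constructor
          · intro h
            rw [Submodule.eq_bot_iff]
            rintro x ⟨⟨hx, hxp⟩, hxπ⟩
            have hx2 : x ∈ μ ⊓ π := ⟨hx, hxπ⟩
            rw [h] at hx2
            obtain ⟨a, rfl⟩ := Submodule.mem_span_singleton.1 hx2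
            have h3 := mem_perp.1 hxp
            rw [herm_smul_left] at h3
            rw [(mul_eq_zero.1 h3).resolve_right hpp₂, zero_smul]
          · intro h
            apply le_antisymm
            · rintro x ⟨hx, hxπ⟩
              have h3 : x - (herm q x p₂ / herm q p p₂) • p ∈ μ ⊓ perp q p₂ ⊓ π :=
                ⟨⟨μ.sub_mem hx (μ.smul_mem _ hpμ), mem_perp.2 (by
                  rw [herm_sub_left, herm_smul_left, div_mul_cancel₀ _ hpp₂, sub_self])⟩,
                  π.sub_mem hxπ (π.smul_mem _ hpπ)⟩
              rw [h, Submodule.mem_bot, sub_eq_zero] at h3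
              exact Submodule.mem_span_singleton.2 ⟨_, h3.symm⟩
            · rw [Submodule.span_singleton_le_iff_mem]
              exact ⟨hpμ, hpπ⟩
        simp only [e1, e2]
        constructor
        · rintro ⟨h, h'⟩
          have h3 : p' ∈ μ ⊓ polar q π := by
            rw [h']; exact Submodule.mem_span_singleton_self _
          exact ⟨⟨h3.1, mem_perp.2 (hσ _ hp'σ _ hp₂)⟩, h, h'⟩
        · rintro ⟨_, h⟩
          exact h)
    have h2 := step_card (m := m) (U := U₁) (v := t) hg (hσU _ hp'σ) hp'p' hpt
      (fun μ => μ ⊓ π = ⊥ ∧ μ ⊓ polar q π = F ∙ p') (fun μ => μ ⊓ A = ⊥) (by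
        intro μ hμ hpμ
        have hν := step_down hg hpt hμ hpμ
        constructor
        · rintro ⟨h, _⟩
          rw [eq_bot_iff, ← h]
          exact inf_le_inf inf_le_left hAπ
        · intro h
          refine ⟨?_, ?_⟩
          · rw [eq_bot_iff, ← h]
            rintro x ⟨hx, hxπ⟩
            exact ⟨⟨hx, mem_perp.2 (hσ' _ ht _ hxπ)⟩,
              mem_red.2 ⟨hxπ, (mem_red.1 (hμ.1 hx)).2⟩⟩
          · apply le_antisymm
            · rintro x ⟨hx, hxσ⟩
              have hsup : (μ ⊓ perp q t) ⊔ A = U := by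
                refine Submodule.eq_of_le_of_finrank_eq (sup_le hν.1 hAU) ?_
                have h3 := Submodule.finrank_sup_add_finrank_inf_eq (μ ⊓ perp q t) A
                rw [h, finrank_bot, hν.2.1] at h3
                omega
              have hyν : x - (herm q x t / herm q p' t) • p' ∈ μ ⊓ perp q t :=
                ⟨μ.sub_mem hx (μ.smul_mem _ hpμ), mem_perp.2 (by
                  rw [herm_sub_left, herm_smul_left, div_mul_cancel₀ _ hpt, sub_self])⟩
              have hyσ : x - (herm q x t / herm q p' t) • p' ∈ polar q π :=
                Submodule.sub_mem _ hxσ (Submodule.smul_mem _ _ hp'σ)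
              have hy0 := hUnd _ (hν.1 hyν) (by
                intro z hz
                rw [← hsup] at hz
                obtain ⟨a, ha, b, hb, rfl⟩ := Submodule.mem_sup.1 hz
                rw [herm_add_right hg, ti_orth hg hν.2.2 hyν ha, hσ _ hyσ _ (hAπ hb), add_zero])
              rw [sub_eq_zero] at hy0
              exact Submodule.mem_span_singleton.2 ⟨_, hy0.symm⟩
            · rw [Submodule.span_singleton_le_iff_mem]
              exact ⟨hpμ, hp'σ⟩)
    exact h1.trans h2

theorem NN_eq (q r s : ℕ) (hq : q ≠ 0) :
    NN q (r + s + 1) ((r : ℤ) - 1) = (q : ℚ) ^ (r ^ 2 + 2 * r * s) *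
      ∏ j ∈ Finset.range s, (q : ℚ) ^ j * ((q : ℚ) ^ (j + 1) - (-1) ^ (j + 1)) := by
  have hq' : (q : ℚ) ≠ 0 := by exact_mod_cast hq
  have e1 : (((r + s + 1 : ℕ) : ℤ) - ((r : ℤ) - 1) - 1).toNat = s + 1 := by push_cast; omega
  have e2 : (((r + s + 1 : ℕ) : ℤ) - ((r : ℤ) - 1) - 2).toNat = s := by push_cast; omega
  rw [NN, e1, e2, Finset.prod_mul_distrib, Finset.prod_pow_eq_pow_sum, ← mul_assoc, ← pow_add]
  congr 1
  rw [← zpow_natCast]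
  congr 1
  have h1 := Finset.sum_range_id_mul_two (s + 1)
  have h2 : ∑ i ∈ Finset.range (s + 1), i = (s + 1).choose 2 := by
    rw [Finset.sum_range_id, Nat.choose_two_right]
  rw [← h2]
  rw [Finset.sum_range_succ] at h1 ⊢
  simp only [Nat.add_sub_cancel] at h1
  have h3 : ((∑ i ∈ Finset.range s, i : ℕ) + (s : ℤ)) * 2 = (s + 1) * s := by exact_mod_cast h1
  push_cast at h3 ⊢
  linarith

end final

/-- The number of generators meeting `π` exactly in the point `P` and `π^σ` exactly
in the point `P'` equals `N(n,i)`. -/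
theorem stmt8 (n q p hh : ℕ) (hn : 1 ≤ n) (hp : p.Prime) (hh1 : 1 ≤ hh)
    (hq : q = p ^ hh)
    (F : Type) [Field F] [Fintype F] (hF : Fintype.card F = q ^ 2)
    (i : ℤ) (hi1 : -1 ≤ i) (hi2 : i ≤ (n:ℤ) - 2)
    (π : Submodule F (Fin (2*n+2) → F)) (hπ : Module.finrank F π = n + 1)
    (hdim : (Module.finrank F ↥(π ⊓ polar q π) : ℤ) = i + 1)
    (P P' : Submodule F (Fin (2*n+2) → F))
    (hP : IsHermPoint q P) (hPπ : P ≤ π) (hPv : ¬ P ≤ π ⊓ polar q π)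
    (hP' : IsHermPoint q P') (hP'σ : P' ≤ polar q π) (hP'v : ¬ P' ≤ π ⊓ polar q π) :
    (Nat.card {μ : Submodule F (Fin (2*n+2) → F) //
        IsGenerator q n μ ∧ μ ⊓ π = P ∧ μ ⊓ polar q π = P'} : ℚ) = NN q n i := by
  have hg := good_of p hh q hp hh1 hq F hF
  obtain ⟨p₁, hp₁, rfl⟩ := exists_span hP.1
  obtain ⟨p₁', hp₁', rfl⟩ := exists_span hP'.1
  rw [Submodule.span_singleton_le_iff_mem] at hPπ hPv hP'σ hP'v
  have hpp := hP.2 p₁ (Submodule.mem_span_singleton_self _)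
  have hpp' := hP'.2 p₁' (Submodule.mem_span_singleton_self _)
  obtain ⟨r, hr⟩ : ∃ r : ℕ, finrank F ↥(π ⊓ polar q π) = r := ⟨_, rfl⟩
  rw [hr] at hdim
  obtain ⟨s, rfl⟩ : ∃ s : ℕ, n = r + s + 1 := ⟨n - 1 - r, by omega⟩
  obtain rfl : i = (r : ℤ) - 1 := by omega
  obtain ⟨U, A, hAU, hUnd, hU, hA, hR, hcard⟩ := reduction hg (m := r + s) π (by ring)
    (by omega) hr p₁ p₁' hpp hpp' hPπ (fun h => hPv ⟨hPπ, h⟩) hP'σ (fun h => hP'v ⟨h, hP'σ⟩)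
  have h1 := main_gen hg s r U A hAU hUnd hU hA hR
  have h2 : Nat.card {μ : Submodule F (Fin (2*(r+s+1)+2) → F) //
        IsGenerator q (r+s+1) μ ∧ μ ⊓ π = F ∙ p₁ ∧ μ ⊓ polar q π = F ∙ p₁'} =
      Nat.card {μ : Submodule F (Fin (2*(r+s+1)+2) → F) // Gen q ⊤ (r + s + 2) μ ∧ p₁ ∈ μ ∧
        (μ ⊓ π = F ∙ p₁ ∧ μ ⊓ polar q π = F ∙ p₁')} := by
    refine Nat.card_congr (Equiv.subtypeEquivRight fun μ => ?_)
    constructor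
    · rintro ⟨h, h3, h4⟩
      refine ⟨⟨le_top, h.1, h.2⟩, ?_, h3, h4⟩
      have : p₁ ∈ μ ⊓ π := by rw [h3]; exact Submodule.mem_span_singleton_self _
      exact this.1
    · rintro ⟨h, _, h3, h4⟩
      exact ⟨⟨h.2.1, h.2.2⟩, h3, h4⟩
  rw [h2, hcard, NN_eq q r s (by have := hg.two_le; omega)]
  have h3 := congrArg (fun z : ℤ => (z : ℚ)) h1
  push_cast at h3
  exact h3

end HermCode
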